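/- arXiv:2507.16243 — 2 statements merged into one kernel-verified Lean document; each statement's English description precedes it below -/
import Mathlib

section
/- Let K be a field of characteristic zero, f ∈ lie_ℓ, g ∈ lie_m, h ∈ lie_n, and 1 ≤ j ≤ ℓ. Then the following associativity identities hold in lie_{ℓ+m+n−2}: (i) if 1 ≤ i ≤ j−1 then (f ∘_j g) ∘_i h = (f ∘_i h) ∘_{j+n−1} g; (ii) if j ≤ i ≤ j+m−1 then (f ∘_j g) ∘_i h = f ∘_j (g ∘_{i−j+1} h); (iii) if j+m ≤ i ≤ ℓ+m−1 then (f ∘_j g) ∘_i h = (f ∘_{i−m+1} h) ∘_j g. -/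
open FreeLieAlgebra

variable (K : Type) [Field K] [CharZero K]

/-- The free Lie algebra over `K` on `N` generators `x_1, …, x_N`
(indexed here 0-based by `Fin N`). -/
abbrev lieF (N : ℕ) : Type := FreeLieAlgebra K (Fin N)

/-- The `(k+1)`-st generator of `lieF K N` (0-based index `k`), junk value `0` out of range. -/
noncomputable def xg (N k : ℕ) : lieF K N :=
  if h : k < N then FreeLieAlgebra.of K (⟨k, h⟩ : Fin N) else 0

/-- The Lie algebra homomorphism `Φ_i : lie_m → lie_{m+n-1}` sending (0-based) `x_j ↦ x_j`
for `j < i`, `x_i ↦ x_i + x_{i+1} + ⋯ + x_{i+n-1}`, and `x_j ↦ x_{j+n-1}` for `j > i`. -/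
noncomputable def PhiL (m n i : ℕ) : lieF K m →ₗ⁅K⁆ lieF K (m + n - 1) :=
  FreeLieAlgebra.lift K fun j : Fin m =>
    if (j : ℕ) < i then xg K (m + n - 1) (j : ℕ)
    else if (j : ℕ) = i then ∑ t : Fin n, xg K (m + n - 1) (i + (t : ℕ))
    else xg K (m + n - 1) ((j : ℕ) + n - 1)

/-- The Lie algebra homomorphism `Ψ_i : lie_n → lie_{m+n-1}` sending (0-based)
`x_j ↦ x_{i+j}`. -/
noncomputable def PsiL (m n i : ℕ) : lieF K n →ₗ⁅K⁆ lieF K (m + n - 1) :=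
  FreeLieAlgebra.lift K fun j : Fin n => xg K (m + n - 1) (i + (j : ℕ))

/-- The partial composition `f ∘_i g := Φ_i(f) + Ψ_i(g)` of free Lie algebra elements
(the pivot `i` is 0-based). -/
noncomputable def compL {m n : ℕ} (f : lieF K m) (i : ℕ) (g : lieF K n) :
    lieF K (m + n - 1) :=
  PhiL K m n i f + PsiL K m n i g

/-- The canonical identification `lie_N ≅ lie_{N'}` for `N = N'`. -/
noncomputable def recastL {N N' : ℕ} (hNN : N = N') : lieF K N →ₗ⁅K⁆ lieF K N' :=
  FreeLieAlgebra.lift K fun j => FreeLieAlgebra.of K (Fin.cast hNN j)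

/-- Inflating the index `s` of a sum to a block of length `n` yields a longer sum. -/
theorem sum_range_inflate {M : Type*} [AddCommMonoid M] (F : ℕ → M) {m n s : ℕ} (hs : s < m)
    (hn : 1 ≤ n) :
    ∑ t ∈ Finset.range m, (if t < s then F t
      else if t = s then ∑ u ∈ Finset.range n, F (s + u) else F (t + n - 1)) =
    ∑ t ∈ Finset.range (m + n - 1), F t := by
  obtain ⟨r, rfl⟩ := Nat.exists_eq_add_of_le (Nat.succ_le_of_lt hs)
  have hlen : s.succ + r + n - 1 = s + n + r := by omega
  rw [hlen, Finset.sum_range_add, Finset.sum_range_succ, Finset.sum_range_add,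
    Finset.sum_range_add]
  congr 1
  · congr 1
    · exact Finset.sum_congr rfl fun t ht => if_pos (Finset.mem_range.1 ht)
    · simp
  · refine Finset.sum_congr rfl fun t _ => ?_
    rw [if_neg (by omega), if_neg (by omega)]
    congr 1
    omega

omit [CharZero K] in
theorem of_eq_xg {N : ℕ} (k : Fin N) : FreeLieAlgebra.of K k = xg K N k := by
  simp [xg]

omit [CharZero K] in
theorem lieF_hom_ext {N : ℕ} {L : Type*} [LieRing L] [LieAlgebra K L] {F G : lieF K N →ₗ⁅K⁆ L}
    (h : ∀ k < N, F (xg K N k) = G (xg K N k)) (x : lieF K N) : F x = G x := by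
  have hFG : F = G := FreeLieAlgebra.hom_ext fun k => by
    rw [of_eq_xg]
    exact h k k.isLt
  rw [hFG]

omit [CharZero K] in
theorem PhiL_xg {m k : ℕ} (n i : ℕ) (hk : k < m) :
    PhiL K m n i (xg K m k) =
      if k < i then xg K (m + n - 1) k
      else if k = i then ∑ t ∈ Finset.range n, xg K (m + n - 1) (i + t)
      else xg K (m + n - 1) (k + n - 1) := by
  rw [← of_eq_xg K ⟨k, hk⟩, PhiL, FreeLieAlgebra.lift_of_apply, Finset.sum_range]

omit [CharZero K] in
theorem PhiL_xg_of_lt {m k : ℕ} (n : ℕ) {i : ℕ} (hk : k < m) (hki : k < i) :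
    PhiL K m n i (xg K m k) = xg K (m + n - 1) k := by
  rw [PhiL_xg K n i hk, if_pos hki]

omit [CharZero K] in
theorem PhiL_xg_self {m i : ℕ} (n : ℕ) (hi : i < m) :
    PhiL K m n i (xg K m i) = ∑ t ∈ Finset.range n, xg K (m + n - 1) (i + t) := by
  rw [PhiL_xg K n i hi, if_neg (lt_irrefl i), if_pos rfl]

omit [CharZero K] in
theorem PhiL_xg_of_gt {m k : ℕ} (n : ℕ) {i : ℕ} (hk : k < m) (hik : i < k) :
    PhiL K m n i (xg K m k) = xg K (m + n - 1) (k + n - 1) := by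
  rw [PhiL_xg K n i hk, if_neg hik.not_gt, if_neg hik.ne']

omit [CharZero K] in
theorem PsiL_xg (m : ℕ) {n k : ℕ} (i : ℕ) (hk : k < n) :
    PsiL K m n i (xg K n k) = xg K (m + n - 1) (i + k) := by
  rw [← of_eq_xg K ⟨k, hk⟩, PsiL, FreeLieAlgebra.lift_of_apply]

omit [CharZero K] in
theorem recastL_xg {N N' : ℕ} (hNN : N = N') (k : ℕ) :
    recastL K hNN (xg K N k) = xg K N' k := by
  subst hNN
  by_cases hk : k < N
  · rw [← of_eq_xg K ⟨k, hk⟩, recastL, FreeLieAlgebra.lift_of_apply]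
    rfl
  · simp [xg, hk]

section Parallel

variable {ℓ m n i j : ℕ}

omit [CharZero K] in
/-- Inflations at two distinct positions commute. -/
theorem PhiL_PhiL_of_lt (hn : 1 ≤ n) (hij : i < j) (hj : j < ℓ) (hm : 1 ≤ m)
    (hN : ℓ + n - 1 + m - 1 = ℓ + m - 1 + n - 1) (f : lieF K ℓ) :
    PhiL K (ℓ + m - 1) n i (PhiL K ℓ m j f) =
      recastL K hN (PhiL K (ℓ + n - 1) m (j + n - 1) (PhiL K ℓ n i f)) := by
  refine lieF_hom_ext K (F := (PhiL K (ℓ + m - 1) n i).comp (PhiL K ℓ m j))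
    (G := (recastL K hN).comp ((PhiL K (ℓ + n - 1) m (j + n - 1)).comp (PhiL K ℓ n i)))
    (fun k hk => ?_) f
  simp only [LieHom.comp_apply]
  rcases lt_trichotomy k j with hkj | rfl | hkj
  · rw [PhiL_xg_of_lt K m hk hkj]
    rcases lt_trichotomy k i with hki | rfl | hki
    · rw [PhiL_xg_of_lt K n (by omega) hki, PhiL_xg_of_lt K n hk hki,
        PhiL_xg_of_lt K m (by omega) (by omega), recastL_xg]
    · rw [PhiL_xg_self K n (by omega), PhiL_xg_self K n hk, map_sum, map_sum]
      refine Finset.sum_congr rfl fun t ht => ?_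
      have := Finset.mem_range.1 ht
      rw [PhiL_xg_of_lt K m (by omega) (by omega), recastL_xg]
    · rw [PhiL_xg_of_gt K n (by omega) hki, PhiL_xg_of_gt K n hk hki,
        PhiL_xg_of_lt K m (by omega) (by omega), recastL_xg]
  · rw [PhiL_xg_self K m hk, PhiL_xg_of_gt K n hk hij, PhiL_xg_self K m (by omega), map_sum,
      map_sum]
    refine Finset.sum_congr rfl fun t ht => ?_
    have := Finset.mem_range.1 ht
    rw [PhiL_xg_of_gt K n (by omega) (by omega), recastL_xg]
    congr 1
    omega
  · rw [PhiL_xg_of_gt K m hk hkj, PhiL_xg_of_gt K n (by omega) (by omega),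
      PhiL_xg_of_gt K n hk (by omega), PhiL_xg_of_gt K m (by omega) (by omega), recastL_xg]
    congr 1
    omega

omit [CharZero K] in
/-- Inflating to the left of an inserted block shifts the block. -/
theorem PhiL_PsiL_of_lt (hn : 1 ≤ n) (hij : i < j) (hj : j < ℓ)
    (hN : ℓ + n - 1 + m - 1 = ℓ + m - 1 + n - 1) (g : lieF K m) :
    PhiL K (ℓ + m - 1) n i (PsiL K ℓ m j g) =
      recastL K hN (PsiL K (ℓ + n - 1) m (j + n - 1) g) := by
  refine lieF_hom_ext K (F := (PhiL K (ℓ + m - 1) n i).comp (PsiL K ℓ m j))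
    (G := (recastL K hN).comp (PsiL K (ℓ + n - 1) m (j + n - 1))) (fun k hk => ?_) g
  simp only [LieHom.comp_apply]
  rw [PsiL_xg K ℓ j hk, PhiL_xg_of_gt K n (by omega) (by omega), PsiL_xg K _ _ hk, recastL_xg]
  congr 1
  omega

omit [CharZero K] in
/-- Inflating to the right of an inserted block leaves the block in place. -/
theorem PsiL_eq_PhiL_PsiL_of_lt (hij : i < j) (hj : j < ℓ)
    (hN : ℓ + n - 1 + m - 1 = ℓ + m - 1 + n - 1) (h : lieF K n) :
    PsiL K (ℓ + m - 1) n i h =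
      recastL K hN (PhiL K (ℓ + n - 1) m (j + n - 1) (PsiL K ℓ n i h)) := by
  refine lieF_hom_ext K (F := PsiL K (ℓ + m - 1) n i)
    (G := (recastL K hN).comp ((PhiL K (ℓ + n - 1) m (j + n - 1)).comp (PsiL K ℓ n i)))
    (fun k hk => ?_) h
  simp only [LieHom.comp_apply]
  rw [PsiL_xg K _ i hk, PsiL_xg K _ i hk, PhiL_xg_of_lt K m (by omega) (by omega), recastL_xg]

omit [CharZero K] in
theorem compL_compL_of_lt (hm : 1 ≤ m) (hn : 1 ≤ n) (hij : i < j) (hj : j < ℓ)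
    (hN : ℓ + n - 1 + m - 1 = ℓ + m - 1 + n - 1)
    (f : lieF K ℓ) (g : lieF K m) (h : lieF K n) :
    compL K (compL K f j g) i h =
      recastL K hN (compL K (compL K f i h) (j + n - 1) g) := by
  simp only [compL, map_add]
  rw [PhiL_PhiL_of_lt K hn hij hj hm hN, PhiL_PsiL_of_lt K hn hij hj hN,
    PsiL_eq_PhiL_PsiL_of_lt K hij hj hN]
  abel

end Parallel

section Sequential

variable {ℓ m n s j : ℕ}

omit [CharZero K] in
/-- Inflating inside an inflated block is a single inflation. -/
theorem PhiL_PhiL_add (hn : 1 ≤ n) (hs : s < m) (hj : j < ℓ)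
    (hN : ℓ + (m + n - 1) - 1 = ℓ + m - 1 + n - 1) (f : lieF K ℓ) :
    PhiL K (ℓ + m - 1) n (j + s) (PhiL K ℓ m j f) =
      recastL K hN (PhiL K ℓ (m + n - 1) j f) := by
  refine lieF_hom_ext K (F := (PhiL K (ℓ + m - 1) n (j + s)).comp (PhiL K ℓ m j))
    (G := (recastL K hN).comp (PhiL K ℓ (m + n - 1) j)) (fun k hk => ?_) f
  simp only [LieHom.comp_apply]
  rcases lt_trichotomy k j with hkj | rfl | hkj
  · rw [PhiL_xg_of_lt K m hk hkj, PhiL_xg_of_lt K n (by omega) (by omega),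
      PhiL_xg_of_lt K _ hk hkj, recastL_xg]
  · rw [PhiL_xg_self K m hk, PhiL_xg_self K _ hk, map_sum, map_sum]
    simp only [recastL_xg]
    rw [← sum_range_inflate (fun t => xg K (ℓ + m - 1 + n - 1) (k + t)) hs hn]
    refine Finset.sum_congr rfl fun t ht => ?_
    have := Finset.mem_range.1 ht
    rw [PhiL_xg K n _ (by omega)]
    simp only [add_lt_add_iff_left, add_right_inj, add_assoc]
    rw [Nat.add_sub_assoc (by omega : 1 ≤ t + n) k]
  · rw [PhiL_xg_of_gt K m hk hkj, PhiL_xg_of_gt K n (by omega) (by omega),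
      PhiL_xg_of_gt K _ hk hkj, recastL_xg]
    congr 1
    omega

omit [CharZero K] in
/-- Inflating inside an inserted block agrees with inserting the inflated block. -/
theorem PhiL_PsiL_add (hs : s < m) (hn : 1 ≤ n) (hj : j < ℓ)
    (hN : ℓ + (m + n - 1) - 1 = ℓ + m - 1 + n - 1) (g : lieF K m) :
    PhiL K (ℓ + m - 1) n (j + s) (PsiL K ℓ m j g) =
      recastL K hN (PsiL K ℓ (m + n - 1) j (PhiL K m n s g)) := by
  refine lieF_hom_ext K (F := (PhiL K (ℓ + m - 1) n (j + s)).comp (PsiL K ℓ m j))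
    (G := (recastL K hN).comp ((PsiL K ℓ (m + n - 1) j).comp (PhiL K m n s)))
    (fun k hk => ?_) g
  simp only [LieHom.comp_apply]
  rw [PsiL_xg K ℓ j hk]
  rcases lt_trichotomy k s with hks | rfl | hks
  · rw [PhiL_xg_of_lt K n (by omega) (by omega), PhiL_xg_of_lt K n hk hks,
      PsiL_xg K ℓ j (by omega), recastL_xg]
  · rw [PhiL_xg_self K n (by omega), PhiL_xg_self K n hk, map_sum, map_sum]
    refine Finset.sum_congr rfl fun t ht => ?_
    have := Finset.mem_range.1 ht
    rw [PsiL_xg K ℓ j (by omega), recastL_xg, add_assoc]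
  · rw [PhiL_xg_of_gt K n (by omega) (by omega), PhiL_xg_of_gt K n hk hks,
      PsiL_xg K ℓ j (by omega), recastL_xg]
    congr 1
    omega

omit [CharZero K] in
/-- Nested insertions compose by adding their offsets. -/
theorem PsiL_add (hs : s < m) (hN : ℓ + (m + n - 1) - 1 = ℓ + m - 1 + n - 1)
    (h : lieF K n) :
    PsiL K (ℓ + m - 1) n (j + s) h =
      recastL K hN (PsiL K ℓ (m + n - 1) j (PsiL K m n s h)) := by
  refine lieF_hom_ext K (F := PsiL K (ℓ + m - 1) n (j + s))
    (G := (recastL K hN).comp ((PsiL K ℓ (m + n - 1) j).comp (PsiL K m n s)))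
    (fun k hk => ?_) h
  simp only [LieHom.comp_apply]
  rw [PsiL_xg K _ _ hk, PsiL_xg K _ _ hk, PsiL_xg K ℓ j (by omega), recastL_xg, add_assoc]

omit [CharZero K] in
theorem compL_compL_add (hs : s < m) (hn : 1 ≤ n) (hj : j < ℓ)
    (hN : ℓ + (m + n - 1) - 1 = ℓ + m - 1 + n - 1)
    (f : lieF K ℓ) (g : lieF K m) (h : lieF K n) :
    compL K (compL K f j g) (j + s) h = recastL K hN (compL K f j (compL K g s h)) := by
  simp only [compL, map_add]
  rw [PhiL_PhiL_add K hn hs hj hN, PhiL_PsiL_add K hs hn hj hN, PsiL_add K hs hN, add_assoc]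

end Sequential

omit [CharZero K] in
theorem recastL_recastL {N N' : ℕ} (hN : N = N') (hN' : N' = N) (x : lieF K N) :
    recastL K hN' (recastL K hN x) = x :=
  lieF_hom_ext K (F := (recastL K hN').comp (recastL K hN)) (G := LieHom.id)
    (fun k _ => by simp [recastL_xg]) x

/-- Associativity of the partial compositions on free Lie algebras.  Here all indices are
0-based, so the paper's `1 ≤ j ≤ ℓ` becomes `j < ℓ`, `1 ≤ i ≤ j-1` becomes `i < j`,
`j ≤ i ≤ j+m-1` becomes `j ≤ i ≤ j+m-1`, `j+m ≤ i ≤ ℓ+m-1` becomes `j+m ≤ i < ℓ+m-1`,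
and the pivots `j+n-1`, `i-j+1`, `i-m+1` become `j+n-1`, `i-j`, `i+1-m` respectively. -/
theorem lie_comp_assoc (ℓ m n : ℕ) (hℓ : 1 ≤ ℓ) (hm : 1 ≤ m) (hn : 1 ≤ n)
    (f : lieF K ℓ) (g : lieF K m) (h : lieF K n) (j : ℕ) (hj : j < ℓ) :
    (∀ i : ℕ, i < j →
      compL K (compL K f j g) i h =
        recastL K (show ℓ + n - 1 + m - 1 = ℓ + m - 1 + n - 1 by omega)
          (compL K (compL K f i h) (j + n - 1) g)) ∧
    (∀ i : ℕ, j ≤ i → i ≤ j + m - 1 →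
      compL K (compL K f j g) i h =
        recastL K (show ℓ + (m + n - 1) - 1 = ℓ + m - 1 + n - 1 by omega)
          (compL K f j (compL K g (i - j) h))) ∧
    (∀ i : ℕ, j + m ≤ i → i < ℓ + m - 1 →
      compL K (compL K f j g) i h =
        recastL K (show ℓ + n - 1 + m - 1 = ℓ + m - 1 + n - 1 by omega)
          (compL K (compL K f (i + 1 - m) h) j g)) := by
  refine ⟨fun i hij => compL_compL_of_lt K hm hn hij hj _ f g h, fun i hji him => ?_,
    fun i hi hiℓ => ?_⟩
  · obtain ⟨s, rfl⟩ := Nat.exists_eq_add_of_le hji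
    simp only [Nat.add_sub_cancel_left]
    exact compL_compL_add K (by omega) hn hj _ f g h
  · obtain ⟨p, rfl⟩ : ∃ p, i = p + m - 1 := ⟨i + 1 - m, by omega⟩
    rw [show p + m - 1 + 1 - m = p by omega,
      compL_compL_of_lt K hn hm (show j < p by omega) (by omega)
        (show ℓ + m - 1 + n - 1 = ℓ + n - 1 + m - 1 by omega) f h g,
      recastL_recastL]
end

section
/- Let K be a field of characteristic zero and n ≥ 3. For 1 ≤ p < q ≤ n, let t^{pq} be the derivation of lie_n with t^{pq}(x_p) = [x_p, x_q], t^{pq}(x_q) = [x_q, x_p], and t^{pq}(x_r) = 0 for r ≠ p, q. Then these derivations satisfy the infinitesimal braid (Drinfeld–Kohno) relations: ⁅t^{ij}, t^{ik} + t^{jk}⁆ = 0 for pairwise distinct i, j, k, and ⁅t^{ij}, t^{kl}⁆ = 0 whenever i, j, k, l are pairwise distinct. -/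
open FreeLieAlgebra

variable (K : Type) [Field K] [CharZero K]

/-- The Lie algebra of derivations of `lieF K N`. -/
abbrev DerL (N : ℕ) : Type := LieDerivation K (lieF K N) (lieF K N)

/-- `isT p q T` says that `T` is the derivation `t^{pq}` of `lie_n`, i.e.
`T(x_p) = [x_p, x_q]`, `T(x_q) = [x_q, x_p]`, and `T(x_r) = 0` for `r ≠ p, q`. -/
def isT {N : ℕ} (p q : Fin N) (T : DerL K N) : Prop :=
  T (FreeLieAlgebra.of K p) = ⁅FreeLieAlgebra.of K p, FreeLieAlgebra.of K q⁆ ∧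
  T (FreeLieAlgebra.of K q) = ⁅FreeLieAlgebra.of K q, FreeLieAlgebra.of K p⁆ ∧
  ∀ r : Fin N, r ≠ p → r ≠ q → T (FreeLieAlgebra.of K r) = 0

/-- The generators of a free Lie algebra span it as a Lie algebra. -/
theorem FreeLieAlgebra.lieSpan_range_of (R X : Type*) [CommRing R] :
    LieSubalgebra.lieSpan R (FreeLieAlgebra R X) (Set.range (FreeLieAlgebra.of R)) = ⊤ := by
  set S := LieSubalgebra.lieSpan R (FreeLieAlgebra R X) (Set.range (FreeLieAlgebra.of R))
  let f : FreeLieAlgebra R X →ₗ⁅R⁆ S := FreeLieAlgebra.lift R fun x ↦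
    ⟨FreeLieAlgebra.of R x, LieSubalgebra.subset_lieSpan ⟨x, rfl⟩⟩
  have hf : S.incl.comp f = LieHom.id := FreeLieAlgebra.hom_ext fun x ↦ by
    simp [f]
  refine eq_top_iff.mpr fun a _ ↦ ?_
  have ha : (f a : FreeLieAlgebra R X) = a := LieHom.congr_fun hf a
  exact ha ▸ (f a).2

/-- Two derivations of a free Lie algebra that agree on the generators are equal. -/
theorem LieDerivation.freeLieAlgebra_ext {R X M : Type*} [CommRing R] [AddCommGroup M]
    [Module R M] [LieRingModule (FreeLieAlgebra R X) M] [LieModule R (FreeLieAlgebra R X) M]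
    {D₁ D₂ : LieDerivation R (FreeLieAlgebra R X) M}
    (h : ∀ x, D₁ (FreeLieAlgebra.of R x) = D₂ (FreeLieAlgebra.of R x)) : D₁ = D₂ :=
  LieDerivation.ext_of_lieSpan_eq_top _ (FreeLieAlgebra.lieSpan_range_of R X)
    (Set.forall_mem_range.mpr h)

/-- The derivations `t^{pq}` of `lie_n` (`n ≥ 3`) satisfy the infinitesimal braid
(Drinfeld–Kohno) relations: `⁅t^{ij}, t^{ik} + t^{jk}⁆ = 0` for pairwise distinct
`i, j, k`, and `⁅t^{ij}, t^{kl}⁆ = 0` for pairwise distinct `i, j, k, l`. -/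
theorem infinitesimal_braid_relations (n : ℕ) (hn : 3 ≤ n) :
    (∀ i j k : Fin n, i ≠ j → i ≠ k → j ≠ k →
      ∀ Tij Tik Tjk : DerL K n,
        isT K i j Tij → isT K i k Tik → isT K j k Tjk →
        ⁅Tij, Tik + Tjk⁆ = 0) ∧
    (∀ i j k l : Fin n,
      i ≠ j → i ≠ k → i ≠ l → j ≠ k → j ≠ l → k ≠ l →
      ∀ Tij Tkl : DerL K n,
        isT K i j Tij → isT K k l Tkl → ⁅Tij, Tkl⁆ = 0) := by
  refine ⟨fun i j k hij hik hjk A B C ⟨hA₁, hA₂, hA₃⟩ ⟨hB₁, hB₂, hB₃⟩ ⟨hC₁, hC₂, hC₃⟩ ↦ ?_,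
    fun i j k l hij hik hil hjk hjl hkl A B ⟨hA₁, hA₂, hA₃⟩ ⟨hB₁, hB₂, hB₃⟩ ↦ ?_⟩
  · have hAk := hA₃ k hik.symm hjk.symm
    have hBj := hB₃ j hij.symm hjk
    have hCi := hC₃ i hij hik
    refine LieDerivation.freeLieAlgebra_ext fun r ↦ ?_
    simp only [LieDerivation.lie_apply, LieDerivation.add_apply, LieDerivation.zero_apply]
    by_cases hi : r = i
    · subst hi
      simp [*]
      rw [← lie_jacobi (of K r) (of K j) (of K k), ← lie_skew (of K j) (of K k),
        ← lie_skew (of K k) (of K r), lie_neg, lie_neg]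
      abel
    by_cases hj : r = j
    · subst hj
      simp [*]
      rw [← lie_jacobi (of K r) (of K i) (of K k), ← lie_skew (of K i) (of K k),
        ← lie_skew (of K k) (of K r), lie_neg, lie_neg]
      abel
    by_cases hk : r = k
    · subst hk
      simp [*]
      rw [← lie_skew (of K j) (of K i), lie_neg, add_neg_cancel]
    simp [hA₃ r hi hj, hB₃ r hi hk, hC₃ r hj hk]
  · have hAk := hA₃ k hik.symm hjk.symm
    have hAl := hA₃ l hil.symm hjl.symm
    have hBi := hB₃ i hik hil
    have hBj := hB₃ j hjk hjl
    refine LieDerivation.freeLieAlgebra_ext fun r ↦ ?_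
    simp only [LieDerivation.lie_apply, LieDerivation.zero_apply]
    by_cases hi : r = i
    · simp [*]
    by_cases hj : r = j
    · simp [*]
    by_cases hk : r = k
    · simp [*]
    by_cases hl : r = l
    · simp [*]
    simp [hA₃ r hi hj, hB₃ r hk hl]
end
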